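/- Let Q = [B | C] be an ice quiver and v a mutable vertex such that the mutable subquiver of μ_v(Q) is either a fork with point of return v or an abundant acyclic quiver in which v is a sink or a source. Write [B^{[v]} | C^{[v]}] = μ_v([B | C]), and suppose: (1) every mutable vertex of μ_v(Q) is red or green; (2) if every entry of b^{[v]}_{vj}·c^{[v]}_j is ≥ 0 for some mutable j ≠ v, then sgn(c^{[v]}_j) = sgn(c^{[v]}_v) or sgn(c^{[v]}_j)·c^{[v]}_j ≥ sgn(c^{[v]}_v)·c^{[v]}_v entrywise; (3) if every entry of b^{[v]}_{vj}·c^{[v]}_j is ≤ 0 for some mutable j ≠ v, then sgn(c^{[v]}_j) = -sgn(c^{[v]}_v); (4) if every entry of b^{[v]}_{ij}·c^{[v]}_j is ≥ 0 for distinct mutable i, j both different from v, then sgn(c^{[v]}_i) = sgn(c^{[v]}_j). Then for every reduced mutation sequence w beginning with v, writing r for the last vertex of w and [B^w | C^w] = μ_w([B | C]): every mutable vertex of μ_w(Q) is red or green; if every entry of b^w_{rj}·c^w_j is ≥ 0 for some mutable j ≠ r, then sgn(c^w_j) = sgn(c^w_r) or sgn(c^w_j)·c^w_j ≥ sgn(c^w_r)·c^w_r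 entrywise; if every entry of b^w_{rj}·c^w_j is ≤ 0 for some mutable j ≠ r, then sgn(c^w_j) = -sgn(c^w_r); and if every entry of b^w_{ij}·c^w_j is ≥ 0 for distinct mutable i, j both different from r, then sgn(c^w_i) = sgn(c^w_j). -/

import Mathlib

open Matrix

section QuiverDefs

variable {V W : Type*}

/-- Mutation of an exchange matrix at the vertex `k`. -/
def mutB [DecidableEq V] (B : Matrix V V ℤ) (k : V) : Matrix V V ℤ :=
  Matrix.of fun i j =>
    if i = k ∨ j = k then -B i j else B i j + (B i k).sign * max (B i k * B k j) 0

/-- Mutation of the `C`-matrix of an extended exchange matrix `[B | C]` at the vertex `k`. -/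
def mutC [DecidableEq V] (B : Matrix V V ℤ) (C : Matrix V W ℤ) (k : V) : Matrix V W ℤ :=
  Matrix.of fun i j =>
    if i = k then -C i j else C i j + (B i k).sign * max (B i k * C k j) 0

/-- One mutation step on an extended exchange matrix `[B | C]`, regarded as a pair `(B, C)`. -/
def mutPair [DecidableEq V] (P : Matrix V V ℤ × Matrix V W ℤ) (k : V) :
    Matrix V V ℤ × Matrix V W ℤ :=
  (mutB P.1 k, mutC P.1 P.2 k)

/-- Iterated mutation of an extended exchange matrix along a list of mutable vertices. -/
def mutSeqPair [DecidableEq V] (P : Matrix V V ℤ × Matrix V W ℤ) (w : List V) :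
    Matrix V V ℤ × Matrix V W ℤ :=
  w.foldl mutPair P

/-- Iterated mutation of an exchange matrix along a list of vertices. -/
def mutSeqB [DecidableEq V] (B : Matrix V V ℤ) (w : List V) : Matrix V V ℤ :=
  w.foldl mutB B

/-- A quiver is abundant if there are at least two arrows between any two distinct vertices. -/
def QAbundant (B : Matrix V V ℤ) : Prop := ∀ i j, i ≠ j → 2 ≤ |B i j|

/-- There is a directed cycle of the quiver `B` all of whose vertices lie in `S`. -/
def HasCycleIn (B : Matrix V V ℤ) (S : Set V) : Prop :=
  ∃ (x : V) (l : List V), x ∈ S ∧ (∀ y ∈ l, y ∈ S) ∧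
    List.Chain (fun i j => 0 < B i j) x (l ++ [x])

/-- A quiver is acyclic if it has no directed cycle. -/
def QAcyclic (B : Matrix V V ℤ) : Prop := ¬ HasCycleIn B Set.univ

/-- The vertex `x` is a source: all arrows at `x` point away from `x`. -/
def QSource (B : Matrix V V ℤ) (x : V) : Prop := ∀ j, 0 ≤ B x j

/-- The vertex `x` is a sink: all arrows at `x` point into `x`. -/
def QSink (B : Matrix V V ℤ) (x : V) : Prop := ∀ j, B x j ≤ 0

/-- `B` is a fork with point of return `r`: it is abundant, not acyclic, the full subquiver
obtained by deleting `r` is acyclic, and for all `i` with `i → r` and `j` with `r → j` one has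
`b_{ji} > b_{ir}` and `b_{ji} > b_{rj}`. -/
def QFork (B : Matrix V V ℤ) (r : V) : Prop :=
  QAbundant B ∧ ¬ QAcyclic B ∧ ¬ HasCycleIn B {x | x ≠ r} ∧
    ∀ i j, 0 < B i r → 0 < B r j → B i r < B j i ∧ B r j < B j i

/-- The mutable vertex `i` is green: its `c`-vector is nonzero with all entries `≥ 0`. -/
def QGreen (C : Matrix V W ℤ) (i : V) : Prop := (∀ j, 0 ≤ C i j) ∧ C i ≠ 0

/-- The mutable vertex `i` is red: its `c`-vector is nonzero with all entries `≤ 0`. -/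
def QRed (C : Matrix V W ℤ) (i : V) : Prop := (∀ j, C i j ≤ 0) ∧ C i ≠ 0

/-- The mutable vertex `i` is blue: its `c`-vector is zero. -/
def QBlue (C : Matrix V W ℤ) (i : V) : Prop := C i = 0

/-- `i` has the same color (red/green/blue) with respect to `C` and to `C'`. -/
def SameColorQ (C C' : Matrix V W ℤ) (i : V) : Prop :=
  (QRed C i ↔ QRed C' i) ∧ (QGreen C i ↔ QGreen C' i) ∧ (QBlue C i ↔ QBlue C' i)

/-- The `c`-vectors of `i` and `j` have the same sign (`sgn(c_i) = sgn(c_j)`). -/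
def SameSignQ (C : Matrix V W ℤ) (i j : V) : Prop :=
  (QGreen C i ∧ QGreen C j) ∨ (QRed C i ∧ QRed C j)

/-- The `c`-vectors of `i` and `j` have opposite signs (`sgn(c_i) = -sgn(c_j)`). -/
def OppSignQ (C : Matrix V W ℤ) (i j : V) : Prop :=
  (QGreen C i ∧ QRed C j) ∨ (QRed C i ∧ QGreen C j)

/-- An ice quiver is uniformly sign-coherent if after every mutation sequence every mutable
vertex is red, green, or blue, and not every mutable vertex of the initial quiver is blue. -/
def USC [DecidableEq V] (P : Matrix V V ℤ × Matrix V W ℤ) : Prop :=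
  (∀ (w : List V) (i : V),
      QRed (mutSeqPair P w).2 i ∨ QGreen (mutSeqPair P w).2 i ∨ QBlue (mutSeqPair P w).2 i) ∧
    ¬ ∀ i, QBlue P.2 i

/-- An ice quiver is strictly sign-coherent if after every mutation sequence every mutable
vertex is red or green. -/
def SSC [DecidableEq V] (P : Matrix V V ℤ × Matrix V W ℤ) : Prop :=
  ∀ (w : List V) (i : V), QRed (mutSeqPair P w).2 i ∨ QGreen (mutSeqPair P w).2 i

/-- The four sign conditions at the distinguished vertex `r`:
(1) every mutable vertex is red or green;
(2) if every entry of `b_{rj}·c_j` is `≥ 0` for some `j ≠ r`, then `sgn(c_j) = sgn(c_r)` or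
    `sgn(c_j)·c_j ≥ sgn(c_r)·c_r` entrywise (i.e. `|c_r| ≤ |c_j|` entrywise);
(3) if every entry of `b_{rj}·c_j` is `≤ 0` for some `j ≠ r`, then `sgn(c_j) = -sgn(c_r)`;
(4) if every entry of `b_{ij}·c_j` is `≥ 0` for distinct `i, j` both `≠ r`,
    then `sgn(c_i) = sgn(c_j)`. -/
def FourConds (Bw : Matrix V V ℤ) (Cw : Matrix V W ℤ) (r : V) : Prop :=
  (∀ i, QRed Cw i ∨ QGreen Cw i) ∧
  (∀ j, j ≠ r → (∀ t, 0 ≤ Bw r j * Cw j t) →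
    (SameSignQ Cw j r ∨ ∀ t, |Cw r t| ≤ |Cw j t|)) ∧
  (∀ j, j ≠ r → (∀ t, Bw r j * Cw j t ≤ 0) → OppSignQ Cw j r) ∧
  (∀ i j, i ≠ j → i ≠ r → j ≠ r → (∀ t, 0 ≤ Bw i j * Cw j t) → SameSignQ Cw i j)

end QuiverDefs

section Aux

variable {V W : Type*}

/-- Quiver part of the invariant: a fork with point of return `r`, or the acyclic analogue. -/
structure PreFork (B : Matrix V V ℤ) (r : V) : Prop where
  skew : ∀ i j, B j i = -B i j
  ab : ∀ i j, i ≠ j → 2 ≤ B i j ∨ B i j ≤ -2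
  tr : ∀ i j k, i ≠ r → j ≠ r → k ≠ r → 0 < B i j → 0 < B j k → 0 < B i k
  ret : ∀ i j, 0 < B i r → 0 < B r j → B i r < B j i ∧ B r j < B j i

/-- Sign part of the invariant; `e` is the sign function. -/
structure SignInv (B : Matrix V V ℤ) (C : Matrix V W ℤ) (r : V) (e : V → ℤ) : Prop where
  pm : ∀ i, e i = 1 ∨ e i = -1
  nn : ∀ i t, 0 ≤ e i * C i t
  nz : ∀ i, C i ≠ 0
  c2 : ∀ j, j ≠ r → 0 < B r j * e j → e j = e r ∨ ∀ t, e r * C r t ≤ e j * C j t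
  c3 : ∀ j, j ≠ r → B r j * e j < 0 → e j = - e r
  c4 : ∀ i j, i ≠ j → i ≠ r → j ≠ r → 0 < B i j * e j → e i = e j

lemma PreFork.neg {B : Matrix V V ℤ} {r : V} (h : PreFork B r) : PreFork (-B) r where
  skew i j := by have := h.skew i j; simp only [Matrix.neg_apply]; omega
  ab i j hij := by have := h.ab i j hij; simp only [Matrix.neg_apply]; omega
  tr i j k hi hj hk h1 h2 := by
    simp only [Matrix.neg_apply] at *
    have := h.tr k j i hk hj hi
    have := h.skew i j
    have := h.skew j k
    have := h.skew i k
    omega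
  ret i j h1 h2 := by
    simp only [Matrix.neg_apply] at *
    have := h.ret j i
    have := h.skew i r
    have := h.skew j r
    have := h.skew i j
    omega

lemma SignInv.neg {B : Matrix V V ℤ} {C : Matrix V W ℤ} {r : V} {e : V → ℤ}
    (h : SignInv B C r e) : SignInv (-B) (-C) r (-e) where
  pm i := by have := h.pm i; simp only [Pi.neg_apply]; omega
  nn i t := by have := h.nn i t; simpa using this
  nz i := by
    intro h0
    apply h.nz i
    funext t
    have := congrFun h0 t
    simpa using this
  c2 j hj hp := by
    have := h.c2 j hj (by simpa using hp)
    simpa using this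
  c3 j hj hp := by
    have := h.c3 j hj (by simpa using hp)
    simp [this]
  c4 i j h1 h2 h3 hp := by
    have := h.c4 i j h1 h2 h3 (by simpa using hp)
    simp [this]

end Aux

section AuxMut

variable {V W : Type*} [DecidableEq V]

lemma mutB_neg (B : Matrix V V ℤ) (k : V) : mutB (-B) k = -mutB B k := by
  ext i j
  simp only [mutB, Matrix.of_apply, Matrix.neg_apply]
  split_ifs
  · rfl
  · simp; ring

lemma mutC_neg (B : Matrix V V ℤ) (C : Matrix V W ℤ) (k : V) :
    mutC (-B) (-C) k = -mutC B C k := by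
  ext i j
  simp only [mutC, Matrix.of_apply, Matrix.neg_apply]
  split_ifs
  · rfl
  · simp; ring

lemma mutB_skew {B : Matrix V V ℤ} (h : ∀ i j, B j i = -B i j) (k : V) (i j : V) :
    mutB B k j i = - mutB B k i j := by
  simp only [mutB, Matrix.of_apply]
  by_cases hi : i = k
  · simp [hi, h k j]
  by_cases hj : j = k
  · simp [hj, h k i]
  simp only [hi, hj, or_self, if_false]
  rw [h i j, h k j, h i k]
  rcases lt_trichotomy (B i k) 0 with h1 | h1 | h1 <;>
  rcases lt_trichotomy (B k j) 0 with h2 | h2 | h2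
  · simp only [Int.sign_neg, Int.sign_eq_neg_one_of_neg, h1, h2]
    ring_nf
  · simp [h2]
  · simp only [Int.sign_neg, Int.sign_eq_neg_one_of_neg, h1, h2, Int.sign_eq_one_of_pos]
    rw [max_eq_right (by nlinarith), max_eq_right (by nlinarith)]; ring
  · simp [h1]
  · simp [h1]
  · simp [h1]
  · simp only [Int.sign_neg, Int.sign_eq_neg_one_of_neg, h1, h2, Int.sign_eq_one_of_pos]
    rw [max_eq_right (by nlinarith), max_eq_right (by nlinarith)]; ring
  · simp [h2]
  · simp only [Int.sign_neg, Int.sign_eq_one_of_pos, h1, h2]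
    ring_nf

lemma mutB_left (B : Matrix V V ℤ) (k j : V) : mutB B k k j = -B k j := by
  simp [mutB]

lemma mutB_right (B : Matrix V V ℤ) (k i : V) : mutB B k i k = -B i k := by
  simp [mutB]

lemma mutB_pass (B : Matrix V V ℤ) {k i j : V} (hi : i ≠ k) (hj : j ≠ k)
    (h1 : 0 < B i k) (h2 : 0 < B k j) : mutB B k i j = B i j + B i k * B k j := by
  simp only [mutB, Matrix.of_apply, hi, hj, or_self, if_false, Int.sign_eq_one_of_pos h1]
  rw [max_eq_left (by positivity)]; ring

lemma mutB_nopass (B : Matrix V V ℤ) {k i j : V} (hi : i ≠ k) (hj : j ≠ k)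
    (h : (0 < B i k ∧ B k j < 0) ∨ (B i k < 0 ∧ 0 < B k j)) : mutB B k i j = B i j := by
  simp only [mutB, Matrix.of_apply, hi, hj, or_self, if_false]
  rw [max_eq_right]
  · ring
  · rcases h with ⟨h1, h2⟩ | ⟨h1, h2⟩ <;> nlinarith

/-- Size of the new arrows through `k`. -/
lemma PreFork.big {B : Matrix V V ℤ} {r : V} (h : PreFork B r) {k : V} (hk : k ≠ r)
    {i j : V} (h1 : 0 < B i k) (h2 : 0 < B k j) (hi : i ≠ k) (hj : j ≠ k) :
    B i k < B i j + B i k * B k j ∧ B k j < B i j + B i k * B k j := by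
  have hij : i ≠ j := by
    rintro rfl
    have := h.skew i k
    omega
  have a1 := h.ab i k hi
  have a2 := h.ab k j hj.symm
  have b1 : 2 ≤ B i k := by omega
  have b2 : 2 ≤ B k j := by omega
  have a3 := h.ab i j hij
  have hs := h.skew i j
  by_cases hp : 0 < B i j
  · constructor <;> nlinarith
  have hir : i = r ∨ j = r := by
    by_contra hc
    push Not at hc
    exact hp (h.tr i k j hc.1 hk hc.2 h1 h2)
  rcases hir with rfl | rfl
  · have := h.ret j k (by omega) h1
    constructor <;> nlinarith
  · have := h.ret k i h2 (by omega)
    constructor <;> nlinarith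

lemma PreFork.skewneg {B : Matrix V V ℤ} {r : V} (h : PreFork B r) {i j : V} (hij : i ≠ j)
    (hp : ¬ 0 < B i j) : 0 < B j i := by
  have := h.ab i j hij
  have := h.skew i j
  omega

/-- New orientation. -/
lemma PreFork.orient {B : Matrix V V ℤ} {r : V} (h : PreFork B r) {k : V} (hk : k ≠ r)
    {i j : V} (hi : i ≠ k) (hj : j ≠ k) (hij : i ≠ j) :
    0 < mutB B k i j ↔ ((0 < B i k ∧ 0 < B k j) ∨ (0 < B i j ∧ ¬ (0 < B j k ∧ 0 < B k i))) := by
  have s1 := h.skew i k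
  have s2 := h.skew j k
  have a1 := h.ab i k hi
  have a2 := h.ab j k hj
  by_cases c1 : 0 < B i k <;> by_cases c2 : 0 < B k j
  · rw [mutB_pass B hi hj c1 c2]
    have := h.big hk c1 c2 hi hj
    constructor
    · intro _; exact Or.inl ⟨c1, c2⟩
    · intro _; omega
  · rw [mutB_nopass B hi hj (by omega)]
    omega
  · rw [mutB_nopass B hi hj (by omega)]
    omega
  · have := mutB_skew h.skew k i j
    have h2 := mutB_pass B hj hi (by omega) (by omega)
    have := h.big hk (i := j) (j := i) (by omega) (by omega) hj hi
    omega

lemma PreFork.orient_r {B : Matrix V V ℤ} {r : V} (h : PreFork B r) {k : V} (hk : k ≠ r)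
    {j : V} (hj : j ≠ k) (hjr : j ≠ r) : 0 < mutB B k r j ↔ 0 < B r k := by
  rw [h.orient hk hk.symm hj hjr.symm]
  have s1 := h.skew r k
  have s2 := h.skew r j
  have s3 := h.skew j k
  have a1 := h.ab r k hk.symm
  have a2 := h.ab r j hjr.symm
  have a3 := h.ab j k hj
  have r1 := h.ret j k
  have r2 := h.ret k j
  omega

lemma PreFork.orient_o {B : Matrix V V ℤ} {r : V} (h : PreFork B r) {k : V} (hk : k ≠ r)
    {i j : V} (hi : i ≠ k) (hj : j ≠ k) (hij : i ≠ j) (hir : i ≠ r) (hjr : j ≠ r) :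
    0 < mutB B k i j ↔ 0 < B i j := by
  rw [h.orient hk hi hj hij]
  have t1 := h.tr i k j hir hk hjr
  have t2 := h.tr j k i hjr hk hir
  have s := h.skew i j
  have : 0 < B j i → ¬ 0 < B i j := by omega
  tauto

lemma PreFork.mut {B : Matrix V V ℤ} {r : V} (h : PreFork B r) {k : V} (hk : k ≠ r) :
    PreFork (mutB B k) k where
  skew := mutB_skew h.skew k
  ab i j hij := by
    by_cases hi : i = k
    · subst hi
      rw [mutB_left]; have := h.ab i j hij; omega
    by_cases hj : j = k
    · subst hj
      rw [mutB_right]; have := h.ab i j hij; omega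
    have s1 := h.skew i k
    have s2 := h.skew j k
    have a1 := h.ab i k hi
    have a2 := h.ab j k hj
    have a3 := h.ab i j hij
    by_cases c1 : 0 < B i k <;> by_cases c2 : 0 < B k j
    · rw [mutB_pass B hi hj c1 c2]
      have := h.big hk c1 c2 hi hj
      omega
    · rw [mutB_nopass B hi hj (by omega)]
      omega
    · rw [mutB_nopass B hi hj (by omega)]
      omega
    · have := mutB_skew h.skew k i j
      have h2 := mutB_pass B hj hi (by omega) (by omega)
      have := h.big hk (i := j) (j := i) (by omega) (by omega) hj hi
      omega
  tr i j l hi hj hl h1 h2 := by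
    have sk := mutB_skew h.skew k
    have hij : i ≠ j := by
      rintro rfl; have := sk i i; omega
    have hjl : j ≠ l := by
      rintro rfl; have := sk j j; omega
    have hil : i ≠ l := by
      rintro rfl; have := sk i j; omega
    by_cases hir : i = r
    · subst hir
      rw [h.orient_r hk hj hij.symm] at h1
      rwa [h.orient_r hk hl hil.symm]
    by_cases hjr : j = r
    · subst hjr
      rw [h.orient_r hk hl hjl.symm] at h2
      have h3 := (h.orient_r hk hi hij).2 h2
      have := sk i j
      omega
    by_cases hlr : l = r
    · subst hlr
      have h3 := h.orient_r hk hi hil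
      have h4 := h.orient_r hk hj hjl
      have := sk l j
      have s5 := sk l i
      have : ¬ 0 < mutB B k l i := by rw [h3, ← h4]; omega
      have h6 : mutB B k l i = B l i ∨ True := Or.inr trivial
      have h7 : 0 < B k l := h.skewneg hk.symm (by rwa [h3] at this)
      have h8 := h.orient hk hi hk.symm hil
      by_cases h9 : 0 < B i k
      · exact h8.2 (Or.inl ⟨h9, h7⟩)
      · have h10 := h.skewneg hi h9
        have h11 : 0 < B i l := by
          apply h.skewneg (Ne.symm hil)
          intro h12
          have := h.ret k i h7 h12
          have := h.skew i k
          omega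
        refine h8.2 (Or.inr ⟨h11, ?_⟩)
        have := h.skew l k
        omega
    rw [h.orient_o hk hi hj hij hir hjr] at h1
    rw [h.orient_o hk hj hl hjl hjr hlr] at h2
    rw [h.orient_o hk hi hl hil hir hlr]
    exact h.tr i j l hir hjr hlr h1 h2
  ret i j h1 h2 := by
    rw [mutB_right] at h1 
    rw [mutB_left] at h2
    have s0 := h.skew k k
    have hi : i ≠ k := by rintro rfl; omega
    have hj : j ≠ k := by rintro rfl; omega
    rw [mutB_right, mutB_left]
    have s1 := h.skew i k
    have s2 := h.skew j k
    rw [mutB_pass B hj hi (by omega) (by omega)]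
    have := h.big hk (i := j) (j := i) (by omega) (by omega) hj hi
    omega

lemma mutC_self (B : Matrix V V ℤ) (C : Matrix V W ℤ) (k : V) (t : W) :
    mutC B C k k t = - C k t := by simp [mutC]

lemma mutC_in (B : Matrix V V ℤ) (C : Matrix V W ℤ) {k i : V} (hi : i ≠ k) (h : 0 < B i k)
    (t : W) (ht : 0 ≤ C k t) : mutC B C k i t = C i t + B i k * C k t := by
  simp only [mutC, Matrix.of_apply, hi, if_false, Int.sign_eq_one_of_pos h]
  rw [max_eq_left (by positivity)]; ring

lemma mutC_out (B : Matrix V V ℤ) (C : Matrix V W ℤ) {k i : V} (hi : i ≠ k) (h : B i k ≤ 0)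
    (t : W) (ht : 0 ≤ C k t) : mutC B C k i t = C i t := by
  simp only [mutC, Matrix.of_apply, hi, if_false]
  rw [max_eq_right (by nlinarith)]; ring

/-- The step of the induction at a green vertex. -/
lemma sign_step {B : Matrix V V ℤ} {C : Matrix V W ℤ} {r k : V} {e : V → ℤ}
    (h : PreFork B r) (s : SignInv B C r e) (hk : k ≠ r) (hg : e k = 1) :
    SignInv (mutB B k) (mutC B C k) k
      (fun i => if i = k then -1 else if 0 < B i k then 1 else e i) := by
  have hCk : ∀ t, 0 ≤ C k t := fun t => by simpa [hg] using s.nn k t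
  have hin : ∀ j, j ≠ k → 0 < B j k → ∀ t, C k t ≤ mutC B C k j t := by
    intro j hj hjk t
    rw [mutC_in B C hj hjk t (hCk t)]
    have a := h.ab j k hj
    have hc := hCk t
    have hn := s.nn j t
    have h2 : 2 * C k t ≤ B j k * C k t := mul_le_mul_of_nonneg_right (by omega) hc
    rcases s.pm j with hp | hp
    · rw [hp] at hn; linarith
    · have hjr : j = r := by
        by_contra hjr
        have := s.c4 j k hj hjr hk (by rw [hg]; omega)
        omega
      subst hjr
      have := s.c2 k hk (by rw [hg]; omega)
      rcases this with h3 | h3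
      · omega
      · have := h3 t
        rw [hp, hg] at this
        linarith
  refine ⟨?_, ?_, ?_, ?_, ?_, ?_⟩
  · intro i
    have := s.pm i
    split_ifs <;> omega
  · intro i t
    split_ifs with h1 h2
    · subst h1; rw [mutC_self]; have := hCk t; linarith
    · have := hin i h1 h2 t; have := hCk t; linarith
    · rw [mutC_out B C h1 (by omega) t (hCk t)]; exact s.nn i t
  · intro i h0
    by_cases h1 : i = k
    · subst h1
      apply s.nz i
      funext t
      have := congrFun h0 t
      rw [mutC_self] at this
      simpa using this
    by_cases h2 : 0 < B i k
    · apply s.nz k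
      funext t
      have := congrFun h0 t
      have := hin i h1 h2 t
      have := hCk t
      simp only [Pi.zero_apply] at *
      omega
    · apply s.nz i
      funext t
      have := congrFun h0 t
      rwa [mutC_out B C h1 (by omega) t (hCk t)] at this
  · intro j hj hp
    simp only [if_neg hj, if_true] at hp ⊢
    rw [mutB_left] at hp
    have sk := h.skew j k
    have a := h.ab j k hj
    split_ifs at hp ⊢ with h2
    · right
      intro t
      rw [mutC_self]
      have := hin j hj h2 t
      linarith
    · left
      rcases s.pm j with h3 | h3
      · rw [h3] at hp; omega
      · exact h3
  · intro j hj hp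
    simp only [if_neg hj, if_true] at hp ⊢
    rw [mutB_left] at hp
    have sk := h.skew j k
    have a := h.ab j k hj
    split_ifs at hp ⊢ with h2
    · rfl
    · rcases s.pm j with h3 | h3
      · rw [h3]; rfl
      · rw [h3] at hp; omega
  · -- no arrow from red to green
    have key : ∀ i j, i ≠ j → i ≠ k → j ≠ k → 0 < mutB B k i j → ¬ 0 < B i k → e i = -1 →
        (0 < B j k ∨ e j = 1) → False := by
      intro i j hij hi hj hp hik hei hej
      have hki := h.skewneg hi hik
      rw [h.orient hk hi hj hij] at hp
      have hp' : 0 < B i j ∧ ¬ (0 < B j k ∧ 0 < B k i) := by tauto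
      have hjk : ¬ 0 < B j k := by tauto
      have hkj := h.skewneg hj hjk
      have hej' : e j = 1 := by tauto
      by_cases hir : i = r
      · subst hir
        have := h.ret k j hki hp'.1
        omega
      by_cases hjr : j = r
      · subst hjr
        have := s.c3 k hk (by rw [hg]; have := h.skew j k; omega)
        omega
      have := s.c4 i j hij hir hjr (by rw [hej']; omega)
      omega
    intro i j hij hi hj hp
    have sk := mutB_skew h.skew k i j
    have k1 := key i j hij hi hj
    have k2 := key j i hij.symm hj hi
    simp only [if_neg hi, if_neg hj] at hp ⊢
    have p1 := s.pm i
    have p2 := s.pm j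
    split_ifs at hp ⊢ with h1 h2 h2
    · rfl
    · rcases p2 with h3 | h3
      · rw [h3]
      · rw [h3] at hp
        exact (k2 (by omega) h2 h3 (Or.inl h1)).elim
    · rcases p1 with h3 | h3
      · exact h3
      · exact (k1 (by omega) h1 h3 (Or.inl h2)).elim
    · rcases p1 with h3 | h3 <;> rcases p2 with h4 | h4
      · omega
      · rw [h4] at hp
        exact (k2 (by omega) h2 h4 (Or.inr h3)).elim
      · rw [h4] at hp
        exact (k1 (by omega) h1 h3 (Or.inr h4)).elim
      · omega

lemma sign_step' {B : Matrix V V ℤ} {C : Matrix V W ℤ} {r k : V}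
    (h : PreFork B r) (s : ∃ e, SignInv B C r e) (hk : k ≠ r) :
    ∃ e, SignInv (mutB B k) (mutC B C k) k e := by
  obtain ⟨e, s⟩ := s
  rcases s.pm k with hg | hg
  · exact ⟨_, sign_step h s hk hg⟩
  · have := (sign_step h.neg s.neg hk (by simp [hg])).neg
    rw [mutB_neg, mutC_neg, neg_neg, neg_neg] at this
    exact ⟨_, this⟩


end AuxMut

section AuxConds

variable {V W : Type*}

lemma SignInv.green {B : Matrix V V ℤ} {C : Matrix V W ℤ} {r : V} {e : V → ℤ}
    (s : SignInv B C r e) {i : V} (h : e i = 1) : QGreen C i :=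
  ⟨fun t => by simpa [h] using s.nn i t, s.nz i⟩


lemma SignInv.red {B : Matrix V V ℤ} {C : Matrix V W ℤ} {r : V} {e : V → ℤ}
    (s : SignInv B C r e) {i : V} (h : e i = -1) : QRed C i :=
  ⟨fun t => by simpa [h] using s.nn i t, s.nz i⟩


lemma SignInv.absC {B : Matrix V V ℤ} {C : Matrix V W ℤ} {r : V} {e : V → ℤ}
    (s : SignInv B C r e) (i : V) (t : W) : |C i t| = e i * C i t := by
  have := s.nn i t
  rcases s.pm i with h | h <;> rw [h] at this ⊢
  · rw [abs_of_nonneg (by linarith)]; ring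
  · rw [abs_of_nonpos (by linarith)]; ring


/-- An entry with the sign of `c_j`. -/
lemma SignInv.entry {B : Matrix V V ℤ} {C : Matrix V W ℤ} {r : V} {e : V → ℤ}
    (s : SignInv B C r e) (j : V) : ∃ t, 0 < e j * C j t := by
  by_contra hc
  push Not at hc
  apply s.nz j
  funext t
  have h1 := hc t
  have h2 := s.nn j t
  rcases s.pm j with h | h <;> rw [h] at h1 h2 <;> simp only [Pi.zero_apply] <;> omega


lemma SignInv.pos_of {B : Matrix V V ℤ} {C : Matrix V W ℤ} {r : V} {e : V → ℤ}
    (s : SignInv B C r e) {j : V} {b : ℤ} (hb : b ≠ 0) (h : ∀ t, 0 ≤ b * C j t) :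
    0 < b * e j := by
  obtain ⟨t, ht⟩ := s.entry j
  have := h t
  rcases s.pm j with h1 | h1 <;> rw [h1] at ht ⊢ <;>
    rcases lt_or_gt_of_ne hb with h2 | h2 <;> nlinarith


lemma SignInv.fourConds {B : Matrix V V ℤ} {C : Matrix V W ℤ} {r : V} {e : V → ℤ}
    (h : PreFork B r) (s : SignInv B C r e) : FourConds B C r := by
  have same : ∀ i j, e i = e j → SameSignQ C i j := by
    intro i j hij
    rcases s.pm i with h1 | h1
    · exact Or.inl ⟨s.green h1, s.green (by omega)⟩
    · exact Or.inr ⟨s.red h1, s.red (by omega)⟩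
  have hne : ∀ i j, i ≠ j → B i j ≠ 0 := fun i j hij => by
    have := h.ab i j hij; omega
  refine ⟨?_, ?_, ?_, ?_⟩
  · intro i
    rcases s.pm i with h1 | h1
    · exact Or.inr (s.green h1)
    · exact Or.inl (s.red h1)
  · intro j hj hp
    rcases s.c2 j hj (s.pos_of (hne r j hj.symm) hp) with h1 | h1
    · exact Or.inl (same _ _ h1)
    · right
      intro t
      rw [s.absC, s.absC]
      exact h1 t
  · intro j hj hp
    have h0 := s.pos_of (j := j) (neg_ne_zero.2 (hne r j hj.symm))
      (fun t => by have := hp t; linarith)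
    have h1 := s.c3 j hj (by linarith)
    rcases s.pm j with h2 | h2
    · exact Or.inl ⟨s.green h2, s.red (by omega)⟩
    · exact Or.inr ⟨s.red h2, s.green (by omega)⟩
  · intro i j hij hi hj hp
    exact same _ _ (s.c4 i j hij hi hj (s.pos_of (hne i j hij) hp))


lemma QGreen.not_red {C : Matrix V W ℤ} {i : V} (h : QGreen C i) : ¬ QRed C i := fun h2 =>
  h.2 (funext fun t => le_antisymm (h2.1 t) (h.1 t))


lemma FourConds.signInv {B : Matrix V V ℤ} {C : Matrix V W ℤ} {r : V}
    (h : FourConds B C r) : ∃ e, SignInv B C r e := by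
  classical
  obtain ⟨f1, f2, f3, f4⟩ := h
  have eg : ∀ i, QGreen C i → (if QGreen C i then (1 : ℤ) else -1) = 1 := fun i hi => if_pos hi
  have er : ∀ i, QRed C i → (if QGreen C i then (1 : ℤ) else -1) = -1 :=
    fun i hi => if_neg fun hg => hg.not_red hi
  have nn : ∀ i t, 0 ≤ (if QGreen C i then (1 : ℤ) else -1) * C i t := by
    intro i t
    rcases f1 i with h1 | h1
    · rw [er i h1]; have := h1.1 t; linarith
    · rw [eg i h1]; have := h1.1 t; linarith
  have pm : ∀ i, (if QGreen C i then (1 : ℤ) else -1) = 1 ∨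
      (if QGreen C i then (1 : ℤ) else -1) = -1 := by
    intro i; split_ifs <;> simp
  have absE : ∀ i t, |C i t| = (if QGreen C i then (1 : ℤ) else -1) * C i t := by
    intro i t
    have := nn i t
    rcases pm i with h | h <;> rw [h] at this ⊢
    · rw [abs_of_nonneg (by linarith)]; ring
    · rw [abs_of_nonpos (by linarith)]; ring
  have same : ∀ i j, SameSignQ C i j → (if QGreen C i then (1 : ℤ) else -1) =
      (if QGreen C j then (1 : ℤ) else -1) := by
    rintro i j (⟨h1, h2⟩ | ⟨h1, h2⟩)
    · rw [eg i h1, eg j h2]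
    · rw [er i h1, er j h2]
  have prod : ∀ (b : ℤ) j t, b * C j t = (b * (if QGreen C j then (1 : ℤ) else -1)) *
      ((if QGreen C j then (1 : ℤ) else -1) * C j t) := by
    intro b j t
    rcases pm j with h | h <;> rw [h] <;> ring
  refine ⟨fun i => if QGreen C i then 1 else -1, pm, nn, ?_, ?_, ?_, ?_⟩
  · intro i
    rcases f1 i with h1 | h1 <;> exact h1.2
  · intro j hj hp
    rcases f2 j hj (fun t => by rw [prod]; exact mul_nonneg hp.le (nn j t)) with h1 | h1
    · exact Or.inl (same _ _ h1)
    · right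
      intro t
      have := h1 t
      rwa [absE, absE] at this
  · intro j hj hp
    rcases f3 j hj (fun t => by
      rw [prod]; exact mul_nonpos_of_nonpos_of_nonneg hp.le (nn j t)) with ⟨h1, h2⟩ | ⟨h1, h2⟩
    · simp only [eg j h1, er r h2]; rfl
    · simp only [er j h1, eg r h2]
  · intro i j hij hi hj hp
    exact same _ _ (f4 i j hij hi hj
      (fun t => by rw [prod]; exact mul_nonneg hp.le (nn j t)))


lemma preFork_of {B : Matrix V V ℤ} {r : V} (sk : ∀ i j, B j i = -B i j) (ab : QAbundant B)
    (ac : ¬ HasCycleIn B {x | x ≠ r})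
    (ret : ∀ i j, 0 < B i r → 0 < B r j → B i r < B j i ∧ B r j < B j i) : PreFork B r where
  skew := sk
  ab i j hij := by
    have := ab i j hij
    rcases le_abs.1 this with h | h
    · exact Or.inl h
    · right; omega
  tr i j k hi hj hk h1 h2 := by
    by_contra h3
    have hik : i ≠ k := by
      rintro rfl; have := sk i j; omega
    have h4 := ab i k hik
    have h5 : 0 < B k i := by
      have := sk i k
      rcases le_abs.1 h4 with h | h <;> omega
    apply ac
    refine ⟨i, [j, k], hi, ?_, ?_⟩
    · intro y hy
      simp only [List.mem_cons, List.not_mem_nil, or_false] at hy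
      rcases hy with rfl | rfl <;> assumption
    · change List.IsChain _ [i, j, k, i]
      simp [h1, h2, h5]
  ret := ret

end AuxConds

section AuxMain

variable {V W : Type*} [DecidableEq V]

lemma main_induct (l : List V) : ∀ (P : Matrix V V ℤ × Matrix V W ℤ) (r : V),
    PreFork P.1 r → (∃ e, SignInv P.1 P.2 r e) → List.IsChain (· ≠ ·) (r :: l) →
    FourConds (mutSeqPair P l).1 (mutSeqPair P l).2 ((r :: l).getLast (by simp)) := by
  induction l with
  | nil =>
    intro P r h1 h2 _
    obtain ⟨e, h2⟩ := h2
    exact h2.fourConds h1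
  | cons k l ih =>
    intro P r h1 h2 h3
    rw [List.isChain_cons_cons] at h3
    have := ih (mutPair P k) k (h1.mut h3.1.symm) (sign_step' h1 h2 h3.1.symm) h3.2
    simpa [mutSeqPair] using this

end AuxMain

/-- Lemma `lem-control-signs-abundant acyclic`. -/
theorem control_signs_abundant_acyclic {n m : ℕ}
    (B : Matrix (Fin n) (Fin n) ℤ) (C : Matrix (Fin n) (Fin m) ℤ)
    (hskew : ∀ i j, B j i = -B i j)
    (v : Fin n)
    (hstart : QFork (mutPair (B, C) v).1 v ∨
      (QAbundant (mutPair (B, C) v).1 ∧ QAcyclic (mutPair (B, C) v).1 ∧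
        (QSource (mutPair (B, C) v).1 v ∨ QSink (mutPair (B, C) v).1 v)))
    (hbase : FourConds (mutPair (B, C) v).1 (mutPair (B, C) v).2 v)
    (w : List (Fin n)) (hw : w ≠ []) (hhead : w.head hw = v)
    (hreduced : List.Chain' (· ≠ ·) w) :
    FourConds (mutSeqPair (B, C) w).1 (mutSeqPair (B, C) w).2 (w.getLast hw) := by
  obtain ⟨v', l, rfl⟩ := List.exists_cons_of_ne_nil hw
  simp only [List.head_cons] at hhead
  subst hhead
  have sk := mutB_skew hskew v'
  have hf : PreFork (mutPair (B, C) v').1 v' := by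
    rcases hstart with h | ⟨ha, hc, hs⟩
    · exact preFork_of sk h.1 h.2.2.1 h.2.2.2
    · refine preFork_of sk ha ?_ ?_
      · rintro ⟨x, l, _, _, h3⟩
        exact hc ⟨x, l, trivial, fun _ _ => trivial, h3⟩
      · intro i j h1 h2
        exfalso
        rcases hs with hs | hs
        · have h3 := hs i
          have h4 : (mutPair (B, C) v').1 v' i = -(mutPair (B, C) v').1 i v' := sk i v'
          omega
        · have := hs j
          omega
  exact main_induct l (mutPair (B, C) v') v' hf hbase.signInv hreduced
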